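/- arXiv:math/0510159 — 3 statements merged into one kernel-verified Lean document; each statement's English description precedes it below -/
import Mathlib

section
/- Suppose x₀ ≥ 0 and x₁ ≥ 0. Then for every n ≥ 0, the row sums satisfy S(n+3) ≥ S(n+2) + S(n+1) + 4·S(n). -/
/-- The random Fibonacci sequence determined by initial values `x0, x1` and the
sign sequence `ε : Fin n → Bool` (`true` ↦ `+1`, `false` ↦ `-1`):
`x 0 = x0`, `x 1 = x1`, `x (k+2) = (±1) * x (k+1) + x k` where the sign is `ε k`. -/
noncomputable def randFib (x0 x1 : ℝ) {n : ℕ} (ε : Fin n → Bool) : ℕ → ℝ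
  | 0 => x0
  | 1 => x1
  | k + 2 =>
      (if h : k < n then (if ε ⟨k, h⟩ then (1 : ℝ) else -1) else 1) *
        randFib x0 x1 ε (k + 1) + randFib x0 x1 ε k

/-- `rowSum x0 x1 n` is the sum of the absolute values of the `n`-th row of the tree
of all `2^n` random Fibonacci sequences with initial values `x0, x1`. -/
noncomputable def rowSum (x0 x1 : ℝ) (n : ℕ) : ℝ :=
  ∑ ε : Fin n → Bool, |randFib x0 x1 ε (n + 1)|

/-- Shifting a random Fibonacci sequence by one step absorbs its first sign into the
initial values. -/
lemma randFib_cons (x0 x1 : ℝ) {n : ℕ} (s : Bool) (ε : Fin n → Bool) (k : ℕ) :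
    randFib x0 x1 (Fin.cons s ε : Fin (n + 1) → Bool) (k + 1) =
      randFib x1 ((if s then (1 : ℝ) else -1) * x1 + x0) ε k := by
  induction k using Nat.twoStepInduction with
  | zero => simp [randFib]
  | one => simp [randFib]
  | more k ih₀ ih₁ =>
    rw [randFib, ih₀, ih₁, randFib]
    by_cases h : k < n
    · have hc : (Fin.cons s ε : Fin (n + 1) → Bool) ⟨k + 1, Nat.succ_lt_succ h⟩ = ε ⟨k, h⟩ :=
        Fin.cons_succ (α := fun _ => Bool) s ε ⟨k, h⟩
      simp [h, hc]
    · simp [h]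

/-- Splitting a row according to the first sign. -/
lemma rowSum_succ (x0 x1 : ℝ) (n : ℕ) :
    rowSum x0 x1 (n + 1) = rowSum x1 (x1 + x0) n + rowSum x1 (-x1 + x0) n := by
  unfold rowSum
  rw [← (Fin.consEquiv fun _ : Fin (n + 1) => Bool).sum_comp, Fintype.sum_prod_type,
    Fintype.sum_bool]
  simp [Fin.consEquiv, randFib_cons]

lemma rowSum_zero (x0 x1 : ℝ) : rowSum x0 x1 0 = |x1| := by
  simp [rowSum, randFib]

lemma rowSum_three_ge (a b : ℝ) :
    rowSum a b 3 ≥ rowSum a b 2 + rowSum a b 1 + 4 * rowSum a b 0 := by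
  simp only [rowSum_succ, rowSum_zero]
  ring_nf
  grind

lemma rowSum_lower_recurrence_real (n : ℕ) (a b : ℝ) :
    rowSum a b (n + 3) ≥ rowSum a b (n + 2) + rowSum a b (n + 1) + 4 * rowSum a b n := by
  induction n generalizing a b with
  | zero => exact rowSum_three_ge a b
  | succ n ih =>
    rw [rowSum_succ a b (n + 3), rowSum_succ a b (n + 2), rowSum_succ a b (n + 1),
      rowSum_succ a b n]
    linarith [ih b (b + a), ih b (-b + a)]

theorem rowSum_lower_recurrence (x0 x1 : ℝ) (hx0 : 0 ≤ x0) (hx1 : 0 ≤ x1) (n : ℕ) :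
    rowSum x0 x1 (n + 3) ≥
      rowSum x0 x1 (n + 2) + rowSum x0 x1 (n + 1) + 4 * rowSum x0 x1 n := by
  exact rowSum_lower_recurrence_real n x0 x1
end

section
/- For all real x₀, x₁ and all n ≥ 0, the row sums of squares satisfy the exact recurrence SS(n+2) = 2·SS(n+1) + 4·SS(n). -/
open Filter

/-- `rowSumSq x0 x1 n` is the sum of the squares of the `n`-th row of the tree
of all `2^n` random Fibonacci sequences with initial values `x0, x1`. -/
noncomputable def rowSumSq (x0 x1 : ℝ) (n : ℕ) : ℝ :=
  ∑ ε : Fin n → Bool, (randFib x0 x1 ε (n + 1)) ^ 2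

/-- Appending a sign does not change the terms computed from the earlier signs. -/
theorem randFib_snoc_of_le (x0 x1 : ℝ) {n : ℕ} (ε : Fin n → Bool) (b : Bool) :
    ∀ k ≤ n + 1, randFib x0 x1 (Fin.snoc ε b : Fin (n + 1) → Bool) k = randFib x0 x1 ε k
  | 0, _ => by simp [randFib]
  | 1, _ => by simp [randFib]
  | k + 2, hk => by
    have hkn : k < n := by omega
    have hsnoc : (Fin.snoc ε b : Fin (n + 1) → Bool) ⟨k, by omega⟩ = ε ⟨k, hkn⟩ :=
      Fin.snoc_castSucc (α := fun _ => Bool) b ε ⟨k, hkn⟩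
    rw [randFib, randFib, randFib_snoc_of_le x0 x1 ε b (k + 1) (by omega),
      randFib_snoc_of_le x0 x1 ε b k (by omega), dif_pos hkn, dif_pos (by omega), hsnoc]

theorem randFib_snoc_add_two (x0 x1 : ℝ) {n : ℕ} (ε : Fin n → Bool) (b : Bool) :
    randFib x0 x1 (Fin.snoc ε b : Fin (n + 1) → Bool) (n + 2) =
      (if b then 1 else -1) * randFib x0 x1 ε (n + 1) + randFib x0 x1 ε n := by
  have hsnoc : (Fin.snoc ε b : Fin (n + 1) → Bool) ⟨n, n.lt_succ_self⟩ = b :=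
    Fin.snoc_last (α := fun _ => Bool) b ε
  rw [randFib, randFib_snoc_of_le x0 x1 ε b (n + 1) le_rfl,
    randFib_snoc_of_le x0 x1 ε b n n.le_succ, dif_pos n.lt_succ_self, hsnoc]

theorem sum_fin_succ_bool_eq_sum_snoc {M : Type*} [AddCommMonoid M] {n : ℕ}
    (f : (Fin (n + 1) → Bool) → M) :
    ∑ ε, f ε = ∑ ε : Fin n → Bool, (f (Fin.snoc ε true) + f (Fin.snoc ε false)) := by
  rw [← (Fin.snocEquiv fun _ : Fin (n + 1) => Bool).sum_comp f, Fintype.sum_prod_type_right]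
  simp [Fin.snocEquiv]

theorem sum_randFib_sq_penultimate (x0 x1 : ℝ) (n : ℕ) :
    ∑ ε : Fin (n + 1) → Bool, (randFib x0 x1 ε (n + 1)) ^ 2 = 2 * rowSumSq x0 x1 n := by
  rw [sum_fin_succ_bool_eq_sum_snoc, rowSumSq, Finset.mul_sum]
  refine Finset.sum_congr rfl fun ε _ => ?_
  rw [randFib_snoc_of_le x0 x1 ε _ _ le_rfl, randFib_snoc_of_le x0 x1 ε _ _ le_rfl]
  ring

theorem rowSumSq_succ (x0 x1 : ℝ) (n : ℕ) :
    rowSumSq x0 x1 (n + 1) =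
      2 * rowSumSq x0 x1 n + 2 * ∑ ε : Fin n → Bool, (randFib x0 x1 ε n) ^ 2 := by
  rw [rowSumSq, sum_fin_succ_bool_eq_sum_snoc, rowSumSq, Finset.mul_sum, Finset.mul_sum,
    ← Finset.sum_add_distrib]
  refine Finset.sum_congr rfl fun ε _ => ?_
  rw [randFib_snoc_add_two, randFib_snoc_add_two]
  simp only [if_true, Bool.false_eq_true, if_false]
  ring

theorem rowSumSq_recurrence (x0 x1 : ℝ) (n : ℕ) :
    rowSumSq x0 x1 (n + 2) = 2 * rowSumSq x0 x1 (n + 1) + 4 * rowSumSq x0 x1 n := by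
  rw [rowSumSq_succ x0 x1 (n + 1), sum_randFib_sq_penultimate]
  ring
end

section
/- Suppose βb < a and βa + β²b < b. Then necessarily a > 0, b > 0 and β² < 1/2, and Σ = β(c + d) + 4b − 2βa. (This is the only case in which a subtraction occurs in the row-sum formula, so exponential decay of the expected value can occur only when β² < 1/2, i.e. β < 1/√2.) -/
theorem halfTree_case_six (β a b c d sigma : ℝ) (hβ : 0 < β) (ha : 0 ≤ a) (hb : 0 ≤ b)
    (hc : c = |a - β * b|) (hd : d = a + β * b)
    (hsigma : sigma = |b - β * c| + |b + β * c| + |b - β * d| + |b + β * d|)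
    (h1 : β * b < a) (h2 : β * a + β ^ 2 * b < b) :
    0 < a ∧ 0 < b ∧ β ^ 2 < 1 / 2 ∧ sigma = β * (c + d) + 4 * b - 2 * β * a := by
  have ha_pos : 0 < a := lt_of_le_of_lt (by positivity) h1
  have hb_pos : 0 < b := lt_of_le_of_lt (by positivity) h2
  have hβa : β ^ 2 * b < β * a := by
    have := mul_lt_mul_of_pos_left h1 hβ
    linarith
  have hβb : 0 ≤ β ^ 2 * b := by positivity
  refine ⟨ha_pos, hb_pos, ?_, ?_⟩
  · exact lt_of_mul_lt_mul_right (by linarith) hb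
  · rw [abs_of_pos (sub_pos.mpr h1)] at hc
    subst hc hd
    rw [hsigma, abs_of_nonneg (by linarith), abs_of_nonneg (by linarith),
      abs_of_nonneg (by linarith), abs_of_nonneg (by linarith)]
    ring
end
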